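/- arXiv:1707.05725 — 7 statements merged into one kernel-verified Lean document; each statement's English description precedes it below -/
import Mathlib

section
/- Let X be a T1 topological space and let X₀ ⊆ X be a subset such that every point x ∈ X₀ is separated in X, meaning that for every x' ∈ X with x' ≠ x there exist open sets V, V' ⊆ X with x ∈ V, x' ∈ V' and V ∩ V' = ∅. Then for every quasi-compact subset C ⊆ X, the intersection C ∩ X₀ is closed in the subspace topology of X₀. -/
/-- If `X` is a T1 topological space and `X₀ ⊆ X` is a subset all of whose points are
separated in `X`, then for every quasi-compact (compact) subset `C ⊆ X`, the set
`C ∩ X₀` is closed in the subspace topology of `X₀`. -/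
theorem stmt0 {X : Type*} [TopologicalSpace X] [T1Space X] (X₀ : Set X)
    (hsep : ∀ x ∈ X₀, ∀ x' : X, x' ≠ x →
      ∃ V V' : Set X, IsOpen V ∧ IsOpen V' ∧ x ∈ V ∧ x' ∈ V' ∧ V ∩ V' = ∅)
    (C : Set X) (hC : IsCompact C) :
    IsClosed {x : X₀ | (x : X) ∈ C ∩ X₀} := by
  rw [← isOpen_compl_iff, isOpen_iff_mem_nhds]
  intro x hx
  have hxC : (x : X) ∉ C := fun h => hx ⟨h, x.2⟩
  have hdisj : Disjoint (nhdsSet C) (nhds (x : X)) := by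
    rw [hC.disjoint_nhdsSet_left]
    intro y hy
    obtain ⟨V, V', hV, hV', hxV, hyV', h⟩ := hsep x x.2 y (ne_of_mem_of_not_mem hy hxC)
    exact (Filter.disjoint_of_disjoint_of_mem (Set.disjoint_iff_inter_eq_empty.mpr h)
      (hV.mem_nhds hxV) (hV'.mem_nhds hyV')).symm
  have hmem : Cᶜ ∈ nhds (x : X) :=
    Filter.disjoint_principal_left.mp (hdisj.mono_left principal_le_nhdsSet)
  filter_upwards [continuous_subtype_val.continuousAt.preimage_mem_nhds hmem] with y hy h
  exact hy h.1
end

section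
/- A subset D ⊆ X is open if and only if the following three conditions hold: (i) the set {λ ∈ ℝ : λ ≠ 0 and q(λ,0) ∈ D} is open in ℝ; (ii) the set {v ∈ ℝ^{2n} : q(0,v) ∈ D} is open in ℝ^{2n}; (iii) if there exists v ∈ ℝ^{2n} with q(0,v) ∈ D, then there exists ε > 0 such that q(λ,0) ∈ D for every λ ∈ ℝ with 0 < |λ| < ε. -/
/-- The equivalence relation on `ℝ × ℝ^{2n}` whose quotient is the unitary dual of the
`(2n+1)`-dimensional Heisenberg group: `(λ,v) ∼ (μ,w)` iff `λ = μ` and (`λ ≠ 0` or `v = w`). -/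
def heisSetoid (n : ℕ) : Setoid (ℝ × (Fin (2 * n) → ℝ)) where
  r p q := p.1 = q.1 ∧ (p.1 ≠ 0 ∨ p.2 = q.2)
  iseqv := by
    constructor
    · exact fun p => ⟨rfl, Or.inr rfl⟩
    · rintro p q ⟨h1, h2⟩
      refine ⟨h1.symm, ?_⟩
      rcases h2 with h | h
      · exact Or.inl (by rw [← h1]; exact h)
      · exact Or.inr h.symm
    · rintro p q r ⟨h1, h2⟩ ⟨h1', h2'⟩
      refine ⟨h1.trans h1', ?_⟩
      rcases h2 with h | h
      · exact Or.inl h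
      · rcases h2' with h' | h'
        · exact Or.inl (by rw [h1]; exact h')
        · exact Or.inr (h.trans h')

/-- The unitary dual of the `(2n+1)`-dimensional Heisenberg group, realized as a
quotient topological space. -/
abbrev HeisDual (n : ℕ) : Type := Quotient (heisSetoid n)

/-- The quotient map `q : ℝ × ℝ^{2n} → X`. -/
def heisQ (n : ℕ) : ℝ × (Fin (2 * n) → ℝ) → HeisDual n := Quotient.mk (heisSetoid n)

theorem heisQ_eq_of_ne_zero {n : ℕ} {l : ℝ} (hl : l ≠ 0) (v w : Fin (2 * n) → ℝ) :
    heisQ n (l, v) = heisQ n (l, w) :=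
  Quotient.sound ⟨rfl, Or.inl hl⟩

theorem isOpen_iff_isOpen_preimage_heisQ {n : ℕ} {D : Set (HeisDual n)} :
    IsOpen D ↔ IsOpen (heisQ n ⁻¹' D) :=
  isOpen_coinduced

/-- Description of the open subsets of the unitary dual of the Heisenberg group. -/
theorem stmt1 (n : ℕ) (hn : 1 ≤ n) (D : Set (HeisDual n)) :
    IsOpen D ↔
      (IsOpen {l : ℝ | l ≠ 0 ∧ heisQ n (l, 0) ∈ D} ∧
       IsOpen {v : Fin (2 * n) → ℝ | heisQ n (0, v) ∈ D} ∧
       ((∃ v : Fin (2 * n) → ℝ, heisQ n (0, v) ∈ D) →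
         ∃ ε : ℝ, 0 < ε ∧ ∀ l : ℝ, 0 < |l| → |l| < ε → heisQ n (l, 0) ∈ D)) := by
  rw [isOpen_iff_isOpen_preimage_heisQ]
  constructor
  · intro h
    have hslice (v : Fin (2 * n) → ℝ) : IsOpen {l : ℝ | heisQ n (l, v) ∈ D} :=
      h.preimage (by fun_prop : Continuous fun l : ℝ => (l, v))
    refine ⟨isOpen_ne.inter (hslice 0),
      h.preimage (by fun_prop : Continuous fun v : Fin (2 * n) → ℝ => ((0 : ℝ), v)), ?_⟩
    rintro ⟨v, hv⟩
    obtain ⟨ε, hε, hball⟩ := Metric.isOpen_iff.mp (hslice v) 0 hv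
    refine ⟨ε, hε, fun l hl hlε => ?_⟩
    rw [heisQ_eq_of_ne_zero (abs_pos.mp hl) 0 v]
    exact hball (by simpa using hlε)
  · rintro ⟨hA, hV, hε⟩
    rw [isOpen_iff_mem_nhds]
    rintro ⟨l, v⟩ hlv
    by_cases hl : l = 0
    · subst hl
      obtain ⟨ε, hε, hD⟩ := hε ⟨v, hlv⟩
      filter_upwards [prod_mem_nhds (Metric.ball_mem_nhds (0 : ℝ) hε) (hV.mem_nhds hlv)]
      rintro ⟨m, w⟩ ⟨hm, hw⟩
      by_cases hm0 : m = 0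
      · subst hm0
        exact hw
      · rw [Set.mem_preimage, heisQ_eq_of_ne_zero hm0 w 0]
        exact hD m (abs_pos.mpr hm0) (by simpa using hm)
    · rw [Set.mem_preimage, heisQ_eq_of_ne_zero hl v 0] at hlv
      filter_upwards [prod_mem_nhds (hA.mem_nhds ⟨hl, hlv⟩) Filter.univ_mem]
      rintro ⟨m, w⟩ ⟨⟨hm0, hm⟩, -⟩
      rw [Set.mem_preimage, heisQ_eq_of_ne_zero hm0 w 0]
      exact hm
end

section
/- A subset C ⊆ X is quasi-compact if and only if the following three conditions hold: (1) the set {v ∈ ℝ^{2n} : q(0,v) ∈ C} is a compact subset of ℝ^{2n}; (2) the set L := {λ ∈ ℝ : λ ≠ 0 and q(λ,0) ∈ C} is bounded in ℝ and closed in the subspace topology of ℝ∖{0}; (3) if 0 belongs to the closure of L in ℝ, then C ∩ Γ₂ ≠ ∅. -/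
theorem heisQ_eq_iff {n : ℕ} {p r : ℝ × (Fin (2 * n) → ℝ)} :
    heisQ n p = heisQ n r ↔ p.1 = r.1 ∧ (p.1 ≠ 0 ∨ p.2 = r.2) :=
  Quotient.eq

theorem continuous_heisQ (n : ℕ) : Continuous (heisQ n) :=
  continuous_quotient_mk'

theorem heisQ_surjective (n : ℕ) : Function.Surjective (heisQ n) :=
  Quotient.mk_surjective

/-- The central parameter `λ` as a function on the dual. -/
def heisParam (n : ℕ) : HeisDual n → ℝ :=
  Quotient.lift Prod.fst fun _ _ h => h.1

@[simp]
theorem heisParam_heisQ (n : ℕ) (p : ℝ × (Fin (2 * n) → ℝ)) : heisParam n (heisQ n p) = p.1 :=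
  rfl

theorem continuous_heisParam (n : ℕ) : Continuous (heisParam n) :=
  continuous_fst.quotient_lift _

/-- The characters form a closed copy of `ℝ^{2n}` in the dual. -/
theorem isClosedEmbedding_heisQ_zero (n : ℕ) :
    Topology.IsClosedEmbedding fun v : Fin (2 * n) → ℝ => heisQ n (0, v) := by
  refine .of_continuous_injective_isClosedMap
    ((continuous_heisQ n).comp (by fun_prop)) ?_ fun F hF => ?_
  · intro v w h
    simpa using heisQ_eq_iff.1 h
  · have hq : Topology.IsQuotientMap (heisQ n) := isQuotientMap_quot_mk
    rw [← hq.isClosed_preimage]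
    convert (isClosed_singleton (x := (0 : ℝ))).prod hF using 1
    ext ⟨l, v⟩
    simp only [Set.mem_preimage, Set.mem_image, heisQ_eq_iff, Set.mem_prod, Set.mem_singleton_iff]
    constructor
    · rintro ⟨w, hw, h, h' | rfl⟩
      · exact absurd rfl h'
      · exact ⟨h.symm, hw⟩
    · rintro ⟨rfl, hv⟩
      exact ⟨v, hv, rfl, Or.inr rfl⟩

/-- The nonzero parameters occurring in `C` are those of the image of `C` other than `0`. -/
theorem mem_heisParam_image_iff {n : ℕ} {C : Set (HeisDual n)} {l : ℝ} (hl : l ≠ 0) :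
    l ∈ heisParam n '' C ↔ heisQ n (l, 0) ∈ C := by
  constructor
  · rintro ⟨x, hx, rfl⟩
    obtain ⟨⟨m, v⟩, rfl⟩ := heisQ_surjective n x
    exact heisQ_eq_of_ne_zero hl v 0 ▸ hx
  · exact fun h => ⟨_, h, rfl⟩

/-- Description of the quasi-compact subsets of the unitary dual of the Heisenberg group.
Here Γ₂ = q({0} × ℝ^{2n}) is the set of characters, and L = {λ ∈ ℝ : λ ≠ 0 and q(λ,0) ∈ C}. -/
theorem stmt3 (n : ℕ) (hn : 1 ≤ n) (C : Set (HeisDual n)) :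
    IsCompact C ↔
      (IsCompact {v : Fin (2 * n) → ℝ | heisQ n (0, v) ∈ C} ∧
       (Bornology.IsBounded {l : ℝ | l ≠ 0 ∧ heisQ n (l, 0) ∈ C} ∧
        IsClosed {l : {x : ℝ // x ≠ 0} | heisQ n (l.1, 0) ∈ C}) ∧
       ((0 : ℝ) ∈ closure {l : ℝ | l ≠ 0 ∧ heisQ n (l, 0) ∈ C} →
         (C ∩ Set.range (fun v : Fin (2 * n) → ℝ => heisQ n (0, v))).Nonempty)) := by
  set L : Set ℝ := {l : ℝ | l ≠ 0 ∧ heisQ n (l, 0) ∈ C} with hL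
  set K : Set (Fin (2 * n) → ℝ) := {v | heisQ n (0, v) ∈ C}
  constructor
  · intro hC
    have hP : IsCompact (heisParam n '' C) := hC.image (continuous_heisParam n)
    have hLP : L ⊆ heisParam n '' C := fun l hl => (mem_heisParam_image_iff hl.1).2 hl.2
    refine ⟨(isClosedEmbedding_heisQ_zero n).isCompact_preimage hC,
      ⟨hP.isBounded.subset hLP, ?_⟩, fun h0 => ?_⟩
    · convert hP.isClosed.preimage (continuous_subtype_val (p := fun x : ℝ => x ≠ 0)) using 1
      ext l
      exact (mem_heisParam_image_iff l.2).symm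
    · obtain ⟨x, hx, hx0⟩ := closure_minimal hLP hP.isClosed h0
      obtain ⟨⟨m, v⟩, rfl⟩ := heisQ_surjective n x
      obtain rfl : m = 0 := hx0
      exact ⟨_, hx, v, rfl⟩
  · rintro ⟨hKc, ⟨hb, hcl⟩, h0⟩
    obtain ⟨T, hT, hTL⟩ := isClosed_induced_iff.1 hcl
    have hL0 : IsClosed (insert 0 L) := by
      convert hT.union (isClosed_singleton (x := (0 : ℝ))) using 1
      ext l
      by_cases hl : l = 0
      · simp [hl]
      · have := Set.ext_iff.1 hTL ⟨l, hl⟩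
        simp only [Set.mem_preimage, Set.mem_ofPred_eq] at this
        simp [hL, hl, this]
    have hcont (v : Fin (2 * n) → ℝ) : Continuous fun l : ℝ => heisQ n (l, v) :=
      (continuous_heisQ n).comp (by fun_prop)
    rcases K.eq_empty_or_nonempty with hKe | ⟨v₀, hv₀⟩
    · have h0L : (0 : ℝ) ∉ closure L := by
        intro h
        obtain ⟨_, hx, v, rfl⟩ := h0 h
        exact hKe.subset (show v ∈ K from hx)
      have hLc : IsClosed L := isClosed_of_closure_subset fun l hl =>
        (closure_minimal (Set.subset_insert 0 L) hL0 hl).resolve_left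
          fun h => h0L (h ▸ hl)
      convert (Metric.isCompact_of_isClosed_isBounded hLc hb).image (hcont 0) using 1
      ext x
      obtain ⟨⟨l, v⟩, rfl⟩ := heisQ_surjective n x
      constructor
      · intro hx
        have hl : l ≠ 0 := by
          rintro rfl
          exact hKe.subset (show v ∈ K from hx)
        exact ⟨l, ⟨hl, heisQ_eq_of_ne_zero hl v 0 ▸ hx⟩, heisQ_eq_of_ne_zero hl 0 v⟩
      · rintro ⟨m, hm, h⟩
        exact h ▸ hm.2
    · convert (hKc.image (isClosedEmbedding_heisQ_zero n).continuous).union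
        ((Metric.isCompact_of_isClosed_isBounded hL0 (hb.insert 0)).image (hcont v₀)) using 1
      ext x
      obtain ⟨⟨l, v⟩, rfl⟩ := heisQ_surjective n x
      constructor
      · intro hx
        by_cases hl : l = 0
        · subst hl
          exact Or.inl ⟨v, hx, rfl⟩
        · exact Or.inr ⟨l, Or.inr ⟨hl, heisQ_eq_of_ne_zero hl v 0 ▸ hx⟩,
            heisQ_eq_of_ne_zero hl v₀ v⟩
      · rintro (⟨w, hw, h⟩ | ⟨m, rfl | hm, h⟩)
        · exact h ▸ hw
        · exact h ▸ hv₀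
        · rw [← h]
          exact (congrArg (· ∈ C) (heisQ_eq_of_ne_zero hm.1 0 v₀)).mp hm.2
end

section
/- There exist quasi-compact subsets C, C' ⊆ X such that the intersection C ∩ C' is not quasi-compact. -/
/-- The central character `λ`, as a function on the unitary dual. -/
def heisCentral (n : ℕ) : HeisDual n → ℝ :=
  Quotient.lift Prod.fst fun _ _ h => h.1

theorem continuous_heisCentral (n : ℕ) : Continuous (heisCentral n) :=
  continuous_fst.quotient_lift _

theorem isCompact_heisQ_image_Icc (n : ℕ) (v : Fin (2 * n) → ℝ) :
    IsCompact ((fun t : ℝ => heisQ n (t, v)) '' Set.Icc 0 1) :=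
  isCompact_Icc.image ((continuous_heisQ n).comp (by fun_prop))

theorem heisCentral_image_inter (n : ℕ) {v w : Fin (2 * n) → ℝ} (hvw : v ≠ w) :
    heisCentral n '' ((fun t : ℝ => heisQ n (t, v)) '' Set.Icc 0 1 ∩
      (fun t : ℝ => heisQ n (t, w)) '' Set.Icc 0 1) = Set.Ioc 0 1 := by
  ext t
  constructor
  · rintro ⟨_, ⟨⟨a, ha, rfl⟩, ⟨b, -, hab⟩⟩, rfl⟩
    obtain ⟨hba : b = a, hb : b ≠ 0 ∨ w = v⟩ := Quotient.exact hab
    have ha0 : a ≠ 0 := hba ▸ hb.resolve_right hvw.symm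
    exact ⟨lt_of_le_of_ne ha.1 ha0.symm, ha.2⟩
  · intro ht
    have htI : t ∈ Set.Icc (0 : ℝ) 1 := ⟨ht.1.le, ht.2⟩
    exact ⟨heisQ n (t, v), ⟨⟨t, htI, rfl⟩, ⟨t, htI, Quotient.sound ⟨rfl, Or.inl ht.1.ne'⟩⟩⟩, rfl⟩

/-- There exist two quasi-compact subsets of the unitary dual of the Heisenberg group
whose intersection fails to be quasi-compact. -/
theorem stmt4 (n : ℕ) (hn : 1 ≤ n) :
    ∃ C C' : Set (HeisDual n), IsCompact C ∧ IsCompact C' ∧ ¬ IsCompact (C ∩ C') := by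
  have : Nonempty (Fin (2 * n)) := ⟨⟨0, by omega⟩⟩
  refine ⟨_, _, isCompact_heisQ_image_Icc n 0, isCompact_heisQ_image_Icc n 1, fun h => ?_⟩
  have hc := h.image (continuous_heisCentral n)
  rw [heisCentral_image_inter n zero_ne_one] at hc
  have h0 : (0 : ℝ) ∈ closure (Set.Ioc (0 : ℝ) 1) := by
    rw [closure_Ioc zero_ne_one]
    exact ⟨le_rfl, zero_le_one⟩
  rw [hc.isClosed.closure_eq] at h0
  exact lt_irrefl 0 h0.1
end

section
/- Let (X, ·, x₀) be a special ℝ-space and suppose X is homeomorphic to ℝ. Then for every x ∈ X∖{x₀} the map ψₓ : ℝ → X, t ↦ t·x, is a homeomorphism of ℝ onto X; in particular ψₓ is surjective. -/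
/-- A *special ℝ-space*: a topological space `X` with a continuous map
`ℝ × X → X`, `(t,x) ↦ t·x`, and a distinguished point `x₀ ∈ X` such that
`0·x = x₀`, `t·x₀ = x₀`, `1·x = x`, `t·(s·x) = (ts)·x`, and for every
`x ≠ x₀` the map `t ↦ t·x` is a homeomorphism of `ℝ` onto its image
(an injective topological embedding). -/
structure SpecialRSpace (X : Type*) [TopologicalSpace X] where
  smul : ℝ → X → X
  basept : X
  continuous_smul : Continuous fun p : ℝ × X => smul p.1 p.2
  zero_smul : ∀ x : X, smul 0 x = basept
  smul_basept : ∀ t : ℝ, smul t basept = basept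
  one_smul : ∀ x : X, smul 1 x = x
  mul_smul : ∀ (t s : ℝ) (x : X), smul t (smul s x) = smul (t * s) x
  embedding_smul : ∀ x : X, x ≠ basept → Topology.IsEmbedding fun t : ℝ => smul t x

/-- The range of a continuous injective function `ℝ → ℝ` is a neighbourhood of each of its
points. -/
theorem range_mem_nhds_of_continuous_injective {f : ℝ → ℝ} (hf : Continuous f)
    (hinj : Function.Injective f) (t : ℝ) : Set.range f ∈ nhds (f t) := by
  have hsub : Set.uIcc (f (t - 1)) (f (t + 1)) ⊆ Set.range f :=
    (intermediate_value_uIcc hf.continuousOn).trans (Set.image_subset_range _ _)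
  rcases hf.strictMono_of_inj hinj with hm | hm
  · refine Filter.mem_of_superset ?_ (Set.Icc_subset_uIcc.trans hsub)
    exact Icc_mem_nhds (hm (by linarith)) (hm (by linarith))
  · refine Filter.mem_of_superset ?_ (Set.Icc_subset_uIcc'.trans hsub)
    exact Icc_mem_nhds (hm (by linarith)) (hm (by linarith))

namespace SpecialRSpace

variable {X : Type*} [TopologicalSpace X] (S : SpecialRSpace X)

/-- In a special `ℝ`-space homeomorphic to `ℝ`, every nontrivial orbit is a neighbourhood of the
base point. -/
theorem range_smul_mem_nhds_basept (e : X ≃ₜ ℝ) {x : X} (hx : x ≠ S.basept) :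
    Set.range (fun t : ℝ => S.smul t x) ∈ nhds S.basept := by
  have hemb := S.embedding_smul x hx
  have key := range_mem_nhds_of_continuous_injective (f := fun t => e (S.smul t x))
    (e.continuous.comp hemb.continuous) (e.injective.comp hemb.injective) 0
  simp only [S.zero_smul] at key
  filter_upwards [e.continuous.continuousAt.preimage_mem_nhds key] with z hz
  obtain ⟨t, ht⟩ := hz
  exact ⟨t, e.injective ht⟩

/-- If the orbits of `x` and `y` share a point other than the base point, then `y` lies in the
orbit of `x`. -/
theorem mem_range_smul_of_mem_inter {x y z : X} (hz : z ≠ S.basept)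
    (hzx : z ∈ Set.range fun t : ℝ => S.smul t x)
    (hzy : z ∈ Set.range fun t : ℝ => S.smul t y) :
    y ∈ Set.range fun t : ℝ => S.smul t x := by
  obtain ⟨t, ht⟩ := hzx
  obtain ⟨s, hs⟩ := hzy
  simp only at ht hs
  have hs0 : s ≠ 0 := by
    rintro rfl
    exact hz (hs ▸ S.zero_smul y)
  refine ⟨s⁻¹ * t, ?_⟩
  simp only
  rw [← S.mul_smul, ht, ← hs, S.mul_smul, inv_mul_cancel₀ hs0, S.one_smul]

theorem surjective_smul (e : X ≃ₜ ℝ) {x : X} (hx : x ≠ S.basept) :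
    Function.Surjective fun t : ℝ => S.smul t x := by
  intro y
  by_cases hy : y = S.basept
  · exact ⟨0, (S.zero_smul x).trans hy.symm⟩
  have hnhds := Filter.inter_mem (S.range_smul_mem_nhds_basept e hx)
    (S.range_smul_mem_nhds_basept e hy)
  rw [← e.symm_apply_apply S.basept] at hnhds
  have hpre := e.symm.continuous.continuousAt.preimage_mem_nhds hnhds
  obtain ⟨r, ⟨hrx, hry⟩, hr⟩ :=
    (((NormedField.nhdsNE_neBot (e S.basept)).nonempty_of_mem
      (Filter.inter_mem (mem_nhdsWithin_of_mem_nhds hpre) self_mem_nhdsWithin)))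
  refine S.mem_range_smul_of_mem_inter (fun h => hr ?_) hrx hry
  rw [← h]
  simp

end SpecialRSpace


/-- If a special ℝ-space `X` is homeomorphic to `ℝ`, then for every `x ∈ X∖{x₀}`
the map `ψₓ : ℝ → X`, `t ↦ t·x`, is a homeomorphism of `ℝ` onto `X`;
in particular `ψₓ` is surjective. -/
theorem stmt6 {X : Type*} [TopologicalSpace X] (S : SpecialRSpace X)
    (h : Nonempty (X ≃ₜ ℝ)) :
    ∀ x : X, x ≠ S.basept →
      IsHomeomorph (fun t : ℝ => S.smul t x) ∧
      Function.Surjective (fun t : ℝ => S.smul t x) := by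
  obtain ⟨e⟩ := h
  intro x hx
  have hsurj := S.surjective_smul e hx
  exact ⟨isHomeomorph_iff_isEmbedding_surjective.mpr ⟨S.embedding_smul x hx, hsurj⟩, hsurj⟩
end

section
/- Let X be a topological space, let r₁, r₂ ≥ 1 be integers, and let V₁, V₂ ⊆ X be open subsets such that, for j = 1, 2, the subspace Vⱼ is homeomorphic to an open subset of ℝ^{rⱼ}. If V₁ ∩ V₂ ≠ ∅, then r₁ = r₂. -/
open MeasureTheory Metric Set Polynomial

/-- Integrating the coefficients of a polynomial over `C(E, ℝ)` integrates its values. -/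
theorem exists_polynomial_eval_eq_setIntegral {E : Type*} [TopologicalSpace E] [T2Space E]
    [MeasurableSpace E] [BorelSpace E] (μ : Measure E) [IsFiniteMeasureOnCompacts μ]
    {s : Set E} (hs : IsCompact s) (P : C(E, ℝ)[X]) :
    ∃ p : ℝ[X], ∀ t : ℝ, p.eval t = ∫ x in s, P.eval (algebraMap ℝ C(E, ℝ) t) x ∂μ := by
  have hint (f : C(E, ℝ)) : IntegrableOn f s μ := f.continuous.continuousOn.integrableOn_compact hs
  induction P using Polynomial.induction_on' with
  | add P Q hP hQ =>
    obtain ⟨p, hp⟩ := hP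
    obtain ⟨q, hq⟩ := hQ
    refine ⟨p + q, fun t ↦ ?_⟩
    simp only [eval_add, ContinuousMap.add_apply, hp, hq]
    exact (integral_add (hint _) (hint _)).symm
  | monomial n f =>
    refine ⟨monomial n (∫ x in s, f x ∂μ), fun t ↦ ?_⟩
    simp [integral_mul_const]

theorem exists_polynomial_eval_eq_det {E : Type*} [NormedAddCommGroup E] [NormedSpace ℝ E]
    [FiniteDimensional ℝ E] {A : E → E →L[ℝ] E} (hA : Continuous A) :
    ∃ P : C(E, ℝ)[X], ∀ (t : ℝ) (x : E),
      P.eval (algebraMap ℝ C(E, ℝ) t) x = (ContinuousLinearMap.id ℝ E + t • A x).det := by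
  let b := Module.finBasis ℝ E
  let M : Matrix (Fin (Module.finrank ℝ E)) (Fin (Module.finrank ℝ E)) C(E, ℝ) := .of fun i j ↦
    ⟨fun x ↦ b.coord i (A x (b j)),
      (LinearMap.continuous_of_finiteDimensional _).comp (hA.clm_apply continuous_const)⟩
  refine ⟨(1 + (X : C(E, ℝ)[X]) • M.map C).det, fun t x ↦ ?_⟩
  let ev : C(E, ℝ)[X] →+* ℝ :=
    (ContinuousMap.evalAlgHom ℝ ℝ x : C(E, ℝ) →+* ℝ).comp (evalRingHom (algebraMap ℝ C(E, ℝ) t))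
  change ev _ = _
  rw [RingHom.map_det, ContinuousLinearMap.det, ← LinearMap.det_toMatrix b]
  congr 1
  ext i j
  by_cases hij : i = j <;>
    simp [ev, M, LinearMap.toMatrix_apply, hij, mul_comm t]

theorem exists_polynomial_eval_eq_sub_norm_sq {E : Type*} [NormedAddCommGroup E]
    [InnerProductSpace ℝ E] {φ : E → E} (hφ : Continuous φ) (c : ℝ) :
    ∃ P : C(E, ℝ)[X], ∀ (t : ℝ) (x : E),
      P.eval (algebraMap ℝ C(E, ℝ) t) x = c - ‖x + t • φ x‖ ^ 2 := by
  refine ⟨C ⟨fun x ↦ c - ‖x‖ ^ 2, by fun_prop⟩ - C ⟨fun x ↦ 2 * inner ℝ x (φ x), by fun_prop⟩ * X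
    - C ⟨fun x ↦ ‖φ x‖ ^ 2, by fun_prop⟩ * X ^ 2, fun t x ↦ ?_⟩
  simp only [eval_sub, eval_C, eval_mul, eval_X, eval_pow, ContinuousMap.sub_apply,
    ContinuousMap.mul_apply, ContinuousMap.pow_apply, ContinuousMap.coe_mk,
    _root_.algebraMap_apply, smul_eq_mul, mul_one, norm_add_sq_real, norm_smul,
    inner_smul_right, mul_pow, Real.norm_eq_abs, sq_abs]
  ring

/-- A perturbation `id + φ` of the identity by a `C¹` map supported in a ball has degree one:
the change of variables formula for `y ↦ (c - ‖y‖ ^ 2) ^ k` holds on that ball, without absolute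
values on the Jacobian. For `id + t • φ` with `t` small this is the usual formula, and both sides
are polynomial in `t`. -/
theorem setIntegral_closedBall_comp_mul_det {E : Type*} [NormedAddCommGroup E]
    [InnerProductSpace ℝ E] [FiniteDimensional ℝ E] [MeasurableSpace E] [BorelSpace E]
    (μ : Measure E) [μ.IsAddHaarMeasure] {φ : E → E} (hφ : ContDiff ℝ 1 φ) {R : ℝ}
    (hR : ∀ x, x ∉ closedBall 0 R → φ x = 0) (c : ℝ) (k : ℕ) :
    ∫ x in closedBall 0 R, (c - ‖x + φ x‖ ^ 2) ^ k *
        (ContinuousLinearMap.id ℝ E + fderiv ℝ φ x).det ∂μ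
      = ∫ x in closedBall 0 R, (c - ‖x‖ ^ 2) ^ k ∂μ := by
  have hsupp : HasCompactSupport φ := .intro (isCompact_closedBall 0 R) hR
  have hdφ : Continuous (fderiv ℝ φ) := hφ.continuous_fderiv one_ne_zero
  obtain ⟨K, hK⟩ := hφ.lipschitzWith_of_hasCompactSupport hsupp one_ne_zero
  have hdet : ∀ᶠ B : E →L[ℝ] E in nhds 0, 0 < (ContinuousLinearMap.id ℝ E + B).det := by
    have : Continuous fun B : E →L[ℝ] E ↦ (ContinuousLinearMap.id ℝ E + B).det :=
      ContinuousLinearMap.continuous_det.comp (by fun_prop)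
    exact (this.tendsto' 0 1 (by simp [ContinuousLinearMap.det])).eventually_const_lt one_pos
  obtain ⟨δ, hδ, hdet⟩ := Metric.eventually_nhds_iff.1 hdet
  have key (t : ℝ) (ht : ‖t‖ * K < min 1 δ) :
      ∫ x in closedBall 0 R, (c - ‖x + t • φ x‖ ^ 2) ^ k *
        (ContinuousLinearMap.id ℝ E + t • fderiv ℝ φ x).det ∂μ
      = ∫ x in closedBall 0 R, (c - ‖x‖ ^ 2) ^ k ∂μ := by
    have hlip (y : E) : ContractingWith (‖t‖₊ * K) fun x ↦ y - t • φ x := by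
      refine ⟨?_, LipschitzWith.of_dist_le_mul fun x z ↦ ?_⟩
      · rw [← NNReal.coe_lt_coe]; simpa using (lt_min_iff.1 ht).1
      · rw [dist_sub_left, dist_smul₀]
        have := hK.dist_le_mul x z
        simp only [NNReal.coe_mul, coe_nnnorm, mul_assoc]
        gcongr
    have hinj : Function.Injective fun x ↦ x + t • φ x := by
      intro x z hxz
      refine (hlip (x + t • φ x)).fixedPoint_unique' (x := x) (y := z) ?_ ?_
      · simp [Function.IsFixedPt]
      · simp only at hxz
        simp [Function.IsFixedPt, hxz]
    have hsurj : Function.Surjective fun x ↦ x + t • φ x := fun y ↦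
      ⟨_, eq_sub_iff_add_eq.1 (hlip y).fixedPoint_isFixedPt.symm⟩
    have himage : (fun x ↦ x + t • φ x) '' closedBall 0 R = closedBall 0 R := by
      have hfix (x) (hx : x ∉ closedBall (0 : E) R) : x + t • φ x = x := by simp [hR x hx]
      apply Subset.antisymm
      · rintro _ ⟨x, hx, rfl⟩
        by_contra h
        have hx' : x + t • φ x = x := hinj (hfix _ h)
        exact h (by simpa only [hx'] using hx)
      · intro y hy
        obtain ⟨x, rfl⟩ := hsurj y
        by_contra h
        refine h ⟨x, ?_, rfl⟩
        by_contra hx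
        exact hx (hfix x hx ▸ hy)
    have hderiv (x : E) : HasFDerivAt (fun x ↦ x + t • φ x)
        (ContinuousLinearMap.id ℝ E + t • fderiv ℝ φ x) x :=
      (hasFDerivAt_id x).add ((hφ.differentiable one_ne_zero x).hasFDerivAt.const_smul t)
    have := integral_image_eq_integral_abs_det_fderiv_smul μ measurableSet_closedBall
      (fun x _ ↦ (hderiv x).hasFDerivWithinAt) (hinj.injOn (s := closedBall 0 R))
      (fun y ↦ (c - ‖y‖ ^ 2) ^ k)
    rw [himage] at this
    rw [this]
    congr 1 with x
    have hpos := hdet (y := t • fderiv ℝ φ x) (by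
      rw [dist_zero_right, norm_smul]
      refine lt_of_le_of_lt ?_ (lt_min_iff.1 ht).2
      gcongr
      exact norm_fderiv_le_of_lipschitz ℝ hK)
    rw [abs_of_pos hpos, smul_eq_mul, mul_comm]
  obtain ⟨P, hP⟩ := exists_polynomial_eval_eq_sub_norm_sq hφ.continuous c
  obtain ⟨Q, hQ⟩ := exists_polynomial_eval_eq_det hdφ
  obtain ⟨p, hp⟩ := exists_polynomial_eval_eq_setIntegral μ (isCompact_closedBall 0 R) (P ^ k * Q)
  simp only [eval_mul, eval_pow, ContinuousMap.mul_apply, ContinuousMap.pow_apply, hP, hQ] at hp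
  have hconst : p = C (∫ x in closedBall 0 R, (c - ‖x‖ ^ 2) ^ k ∂μ) := by
    refine eq_of_infinite_eval_eq _ _ (Set.Infinite.mono (s := {t : ℝ | ‖t‖ * K < min 1 δ}) ?_ ?_)
    · intro t ht
      simpa using (hp t).trans (key t ht)
    · refine infinite_of_mem_nhds 0 (IsOpen.mem_nhds ?_ ?_)
      · exact isOpen_lt (by fun_prop) continuous_const
      · simpa using hδ
  simpa [hconst] using (hp 1).symm

/-- A `C¹` map equal to the identity outside a ball takes values arbitrarily close to the center
at points where its derivative is invertible. -/
theorem exists_det_ne_zero_norm_lt {E : Type*} [NormedAddCommGroup E] [InnerProductSpace ℝ E]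
    [FiniteDimensional ℝ E] {φ : E → E} (hφ : ContDiff ℝ 1 φ) {R : ℝ} (hR0 : 0 < R)
    (hR : ∀ x, x ∉ closedBall 0 R → φ x = 0) {δ : ℝ} (hδ : 0 < δ) :
    ∃ x ∈ closedBall 0 R,
      (ContinuousLinearMap.id ℝ E + fderiv ℝ φ x).det ≠ 0 ∧ ‖x + φ x‖ < δ := by
  borelize E
  let μ : Measure E := volume
  by_contra! H
  have hB := isCompact_closedBall (0 : E) R
  have hcdet : Continuous fun x ↦ (ContinuousLinearMap.id ℝ E + fderiv ℝ φ x).det :=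
    ContinuousLinearMap.continuous_det.comp
      (continuous_const.add (hφ.continuous_fderiv one_ne_zero))
  have hcφ := hφ.continuous
  obtain ⟨D, hD⟩ := hB.exists_bound_of_continuousOn hcdet.continuousOn
  obtain ⟨M, hM⟩ := hB.exists_bound_of_continuousOn (f := fun x ↦ x + φ x) (by fun_prop)
  obtain ⟨c, hcM, hcR, hcδ⟩ : ∃ c : ℝ, M ^ 2 ≤ c ∧ R ^ 2 ≤ c ∧ δ ^ 2 < c :=
    ⟨M ^ 2 + R ^ 2 + δ ^ 2 + 1, by nlinarith, by nlinarith, by nlinarith⟩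
  set r := min (δ / 2) R
  have hr : 0 < r := by positivity
  have hrδ : r < δ := (min_le_left _ _).trans_lt (by linarith)
  have hle (k : ℕ) : (c - r ^ 2) ^ k * μ.real (closedBall 0 r) ≤
      (c - δ ^ 2) ^ k * D * μ.real (closedBall 0 R) := by
    calc (c - r ^ 2) ^ k * μ.real (closedBall 0 r)
        = ∫ x in closedBall 0 r, (c - r ^ 2) ^ k ∂μ := by simp [mul_comm]
      _ ≤ ∫ x in closedBall 0 r, (c - ‖x‖ ^ 2) ^ k ∂μ := by
        refine setIntegral_mono_on ?_ ?_ measurableSet_closedBall fun x hx ↦ ?_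
        · exact continuousOn_const.integrableOn_compact (isCompact_closedBall 0 r)
        · exact ContinuousOn.integrableOn_compact (isCompact_closedBall 0 r) (by fun_prop)
        · rw [mem_closedBall_zero_iff] at hx
          have : 0 ≤ c - r ^ 2 := by nlinarith
          gcongr
      _ ≤ ∫ x in closedBall 0 R, (c - ‖x‖ ^ 2) ^ k ∂μ := by
        refine setIntegral_mono_set (ContinuousOn.integrableOn_compact hB (by fun_prop)) ?_
          (closedBall_subset_closedBall (min_le_right _ _)).eventuallyLE
        refine (ae_restrict_iff' measurableSet_closedBall).2 (.of_forall fun x hx ↦ ?_)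
        rw [mem_closedBall_zero_iff] at hx
        have : ‖x‖ ^ 2 ≤ R ^ 2 := by gcongr
        exact pow_nonneg (by linarith) k
      _ = ∫ x in closedBall 0 R, (c - ‖x + φ x‖ ^ 2) ^ k *
          (ContinuousLinearMap.id ℝ E + fderiv ℝ φ x).det ∂μ :=
        (setIntegral_closedBall_comp_mul_det μ hφ hR c k).symm
      _ ≤ ‖∫ x in closedBall 0 R, (c - ‖x + φ x‖ ^ 2) ^ k *
          (ContinuousLinearMap.id ℝ E + fderiv ℝ φ x).det ∂μ‖ := Real.le_norm_self _
      _ ≤ (c - δ ^ 2) ^ k * D * μ.real (closedBall 0 R) := by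
        refine norm_setIntegral_le_of_norm_le_const measure_closedBall_lt_top fun x hx ↦ ?_
        have hDx := hD x hx
        have hMx := hM x hx
        by_cases hx0 : (ContinuousLinearMap.id ℝ E + fderiv ℝ φ x).det = 0
        · rw [hx0] at hDx ⊢
          have : 0 ≤ D := by simpa using hDx
          have : 0 ≤ c - δ ^ 2 := by linarith
          simp only [mul_zero, norm_zero]
          positivity
        · have h1 : ‖x + φ x‖ ^ 2 ≤ M ^ 2 := by gcongr
          have h2 := H x hx hx0
          have h3 : 0 ≤ c - ‖x + φ x‖ ^ 2 := by linarith
          rw [norm_mul, norm_pow, Real.norm_of_nonneg h3]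
          gcongr
  have ha : 0 < c - δ ^ 2 := by linarith
  have hab : c - δ ^ 2 < c - r ^ 2 := by gcongr
  have hμ : 0 < μ.real (closedBall 0 r) :=
    ENNReal.toReal_pos (measure_closedBall_pos μ _ hr).ne' measure_closedBall_lt_top.ne
  obtain ⟨k, hk⟩ := pow_unbounded_of_one_lt (D * μ.real (closedBall 0 R) / μ.real (closedBall 0 r))
    ((one_lt_div ha).2 hab)
  rw [div_pow, div_lt_div_iff₀ hμ (by positivity)] at hk
  linarith [hle k]

theorem exists_contDiff_comp_dist_lt {E F : Type*} [NormedAddCommGroup E] [NormedSpace ℝ E]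
    [FiniteDimensional ℝ E] [NormedAddCommGroup F]
    [NormedSpace ℝ F] [FiniteDimensional ℝ F]
    {h : E → F} {g : F → E} (hh : Continuous h) (hg : Continuous g)
    {s : Set E} (hs : IsCompact s) {ε : ℝ} (hε : 0 < ε) :
    ∃ (h' : E → F) (g' : F → E), ContDiff ℝ 1 h' ∧ ContDiff ℝ 1 g' ∧
      ∀ x ∈ s, dist (g' (h' x)) (g (h x)) < ε := by
  obtain ⟨g', hg', hgg', -⟩ := hg.exists_contDiff_approx 1 (ε := fun _ ↦ ε / 2)
    continuous_const (by simp [hε])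
  obtain ⟨δ, hδ, hunif⟩ := Metric.mem_uniformity_dist.1 <|
    (hs.image hh).uniformContinuousAt_of_continuousAt g (fun _ _ ↦ hg.continuousAt)
      (Metric.dist_mem_uniformity (half_pos hε))
  obtain ⟨h', hh', hhh', -⟩ := hh.exists_contDiff_approx 1 (ε := fun _ ↦ δ)
    continuous_const (by simp [hδ])
  refine ⟨h', g', hh', hg', fun x hx ↦ ?_⟩
  have h1 : dist (g (h x)) (g (h' x)) < ε / 2 :=
    hunif (a := h x) (b := h' x) (by rw [dist_comm]; exact hhh' x) (mem_image_of_mem h hx)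
  linarith [dist_triangle_right (g' (h' x)) (g (h x)) (g (h' x)), hgg' (h' x)]

theorem finrank_le_of_leftInvOn_closedBall {E F : Type*} [NormedAddCommGroup E]
    [InnerProductSpace ℝ E] [FiniteDimensional ℝ E] [NormedAddCommGroup F]
    [NormedSpace ℝ F] [FiniteDimensional ℝ F]
    {h : E → F} {g : F → E} (hh : Continuous h)
    (hg : Continuous g) {R : ℝ} (hR : 0 < R) (hgh : LeftInvOn g h (closedBall 0 R)) :
    Module.finrank ℝ E ≤ Module.finrank ℝ F := by
  by_contra! hlt
  obtain ⟨h', g', hh', hg', happrox⟩ := exists_contDiff_comp_dist_lt hh hg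
    (isCompact_closedBall 0 R) (show 0 < R / 4 by positivity)
  let χ : ContDiffBump (0 : E) := ⟨R / 2, R, by positivity, by linarith⟩
  have hcomp : ContDiff ℝ 1 (fun x ↦ g' (h' x)) := hg'.comp hh'
  let φ : E → E := fun x ↦ χ x • (g' (h' x) - x)
  have hφ : ContDiff ℝ 1 φ := χ.contDiff.smul (hcomp.sub contDiff_id)
  obtain ⟨x, hx, hdet, hlt'⟩ := exists_det_ne_zero_norm_lt hφ hR
    (fun x hx ↦ by simp [φ, χ.zero_of_le_dist (le_of_lt (by simpa using hx))])
    (show 0 < R / 4 by positivity)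
  have hdist : ‖g' (h' x) - x‖ < R / 4 := by
    simpa [hgh hx, dist_eq_norm] using happrox x hx
  have hxR : ‖x‖ < R / 2 := by
    have h1 : ‖φ x‖ ≤ ‖g' (h' x) - x‖ := by
      rw [norm_smul, Real.norm_of_nonneg χ.nonneg]
      exact mul_le_of_le_one_left (norm_nonneg _) χ.le_one
    have h2 : ‖x‖ ≤ ‖x + φ x‖ + ‖φ x‖ := by simpa using norm_sub_le (x + φ x) (φ x)
    linarith
  have heq : (fun y ↦ y + φ y) =ᶠ[nhds x] fun y ↦ g' (h' y) := by
    filter_upwards [isOpen_ball.mem_nhds (mem_ball_zero_iff.2 hxR)] with y hy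
    simp [φ, χ.one_of_mem_closedBall (ball_subset_closedBall hy)]
  have hderiv : ContinuousLinearMap.id ℝ E + fderiv ℝ φ x =
      (fderiv ℝ g' (h' x)).comp (fderiv ℝ h' x) := by
    refine HasFDerivAt.unique (f := fun y ↦ y + φ y) (x := x)
      ((hasFDerivAt_id x).add (hφ.differentiable one_ne_zero x).hasFDerivAt) ?_
    refine HasFDerivAt.congr_of_eventuallyEq ?_ heq
    exact (hg'.differentiable one_ne_zero _).hasFDerivAt.comp x
      (hh'.differentiable one_ne_zero x).hasFDerivAt
  refine hdet ?_
  rw [hderiv, ContinuousLinearMap.det, LinearMap.det_eq_zero_iff_ker_ne_bot]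
  have hker := LinearMap.ker_ne_bot_of_finrank_lt (f := (fderiv ℝ h' x : E →ₗ[ℝ] F)) hlt
  exact ne_bot_of_le_ne_bot hker (LinearMap.ker_le_ker_comp _ _)

/-- A closed ball embeds only in spaces of at least its own dimension. -/
theorem finrank_le_of_injective_closedBall {E F : Type*} [NormedAddCommGroup E]
    [InnerProductSpace ℝ E] [FiniteDimensional ℝ E] [NormedAddCommGroup F]
    [NormedSpace ℝ F] [FiniteDimensional ℝ F]
    {p : E} {R : ℝ} (hR : 0 < R)
    {h : closedBall p R → F} (hh : Continuous h) (hinj : Function.Injective h) :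
    Module.finrank ℝ E ≤ Module.finrank ℝ F := by
  obtain ⟨h', hh'⟩ := ContinuousMap.exists_extension'
    (isClosed_closedBall (x := p) (ε := R)).isClosedEmbedding_subtypeVal ⟨h, hh⟩
  obtain ⟨g, hg⟩ := ContinuousMap.exists_extension' (hh.isClosedEmbedding hinj)
    ⟨((↑) : closedBall p R → E), continuous_subtype_val⟩
  refine finrank_le_of_leftInvOn_closedBall (h := fun x ↦ h' (x + p)) (g := fun y ↦ g y - p)
    (by fun_prop) (by fun_prop) hR fun x hx ↦ ?_
  have hx' : x + p ∈ closedBall p R := by simpa using hx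
  have h1 : h' (x + p) = h ⟨x + p, hx'⟩ := congr_fun hh' ⟨x + p, hx'⟩
  have h2 : g (h ⟨x + p, hx'⟩) = x + p := congr_fun hg ⟨x + p, hx'⟩
  simp [h1, h2]

theorem finrank_le_of_homeomorph_open {E F : Type*} [NormedAddCommGroup E] [InnerProductSpace ℝ E]
    [FiniteDimensional ℝ E] [NormedAddCommGroup F]
    [NormedSpace ℝ F] [FiniteDimensional ℝ F]
    {X : Type*} [TopologicalSpace X] {V W : Set X}
    (hW : IsOpen W) {U : Set E} (hU : IsOpen U) (e : V ≃ₜ U) {U' : Set F}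
    (e' : W ≃ₜ U') (hne : (V ∩ W).Nonempty) :
    Module.finrank ℝ E ≤ Module.finrank ℝ F := by
  obtain ⟨x, hxV, hxW⟩ := hne
  let S : Set E := (↑) '' {u : U | (e.symm u : X) ∈ W}
  have hS : IsOpen S :=
    hU.isOpenMap_subtype_val _ (hW.preimage (continuous_subtype_val.comp e.symm.continuous))
  have hxS : (e ⟨x, hxV⟩ : E) ∈ S := ⟨e ⟨x, hxV⟩, by simpa using hxW, rfl⟩
  obtain ⟨R, hR, hRS⟩ := Metric.nhds_basis_closedBall.mem_iff.1 (hS.mem_nhds hxS)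
  have hmem (y : closedBall (e ⟨x, hxV⟩ : E) R) :
      ∃ hy : (y : E) ∈ U, (e.symm ⟨y, hy⟩ : X) ∈ W := by
    obtain ⟨u, hu, huy⟩ := hRS y.2
    have hyu : (⟨y, huy ▸ u.2⟩ : U) = u := Subtype.ext huy.symm
    exact ⟨huy ▸ u.2, by rw [hyu]; exact hu⟩
  choose hyU hyW using hmem
  refine finrank_le_of_injective_closedBall hR (h := fun y ↦ (e' ⟨e.symm ⟨y, hyU y⟩, hyW y⟩ : F))
    ?_ ?_
  · exact continuous_subtype_val.comp <| e'.continuous.comp <| Continuous.subtype_mk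
      (continuous_subtype_val.comp <| e.symm.continuous.comp <|
        Continuous.subtype_mk continuous_subtype_val _) _
  · intro y z hyz
    have h1 : (e.symm ⟨y, hyU y⟩ : X) = e.symm ⟨z, hyU z⟩ :=
      Subtype.mk.inj (e'.injective (Subtype.ext hyz))
    have h2 := e.symm.injective (Subtype.ext h1)
    exact Subtype.ext (Subtype.mk.inj h2)


/-- Invariance of dimension: if two open subsets `V₁, V₂` of a topological space `X` are
homeomorphic to open subsets of `ℝ^{r₁}` and `ℝ^{r₂}` respectively, with `r₁, r₂ ≥ 1`,
and `V₁ ∩ V₂ ≠ ∅`, then `r₁ = r₂`. -/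
theorem stmt10 {X : Type*} [TopologicalSpace X] (r₁ r₂ : ℕ) (hr₁ : 1 ≤ r₁) (hr₂ : 1 ≤ r₂)
    (V₁ V₂ : Set X) (hV₁ : IsOpen V₁) (hV₂ : IsOpen V₂)
    (h₁ : ∃ U : Set (EuclideanSpace ℝ (Fin r₁)), IsOpen U ∧ Nonempty (V₁ ≃ₜ U))
    (h₂ : ∃ U : Set (EuclideanSpace ℝ (Fin r₂)), IsOpen U ∧ Nonempty (V₂ ≃ₜ U))
    (hne : (V₁ ∩ V₂).Nonempty) :
    r₁ = r₂ := by
  obtain ⟨U₁, hU₁, ⟨e₁⟩⟩ := h₁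
  obtain ⟨U₂, hU₂, ⟨e₂⟩⟩ := h₂
  apply le_antisymm
  · simpa using finrank_le_of_homeomorph_open hV₂ hU₁ e₁ e₂ hne
  · simpa using finrank_le_of_homeomorph_open hV₁ hU₂ e₂ e₁ (inter_comm V₁ V₂ ▸ hne)
end

section
/- The set of Dini functions on X is not closed under pointwise sum, pointwise product, or pointwise minimum: there exist Dini functions f₁, g₁ on X such that f₁ + g₁ is not a Dini function, Dini functions f₂, g₂ such that f₂ · g₂ is not a Dini function, and Dini functions f₃, g₃ such that min(f₃, g₃) is not a Dini function. -/
/-- `f : X → ℝ` is a *Dini function* if it is nonnegative, bounded, lower semicontinuous,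
and for every upwards directed net `(f_j)` of nonnegative lower semicontinuous functions
whose pointwise supremum is `f`, the net `(f_j)` converges to `f` uniformly on `X`. -/
def IsDiniFunction {X : Type*} [TopologicalSpace X] (f : X → ℝ) : Prop :=
  (∀ x, 0 ≤ f x) ∧ (∃ M : ℝ, ∀ x, f x ≤ M) ∧ LowerSemicontinuous f ∧
    ∀ (J : Type) (_ : Preorder J) (_ : Nonempty J) (_ : IsDirected J (· ≤ ·))
      (F : J → X → ℝ),
      (∀ j x, 0 ≤ F j x) → (∀ j, LowerSemicontinuous (F j)) → Monotone F →
      (∀ x, IsLUB (Set.range fun j => F j x) (f x)) →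
      TendstoUniformly F f Filter.atTop

/-- One-sided Dini theorem: a directed family of lower semicontinuous functions with continuous
supremum on a compact set is eventually uniformly close to it there. -/
theorem IsCompact.exists_forall_sub_lt_of_lowerSemicontinuous {Y J : Type*} [TopologicalSpace Y]
    [Preorder J] [Nonempty J] [IsDirected J (· ≤ ·)] {K : Set Y} (hK : IsCompact K)
    {g : Y → ℝ} (hg : Continuous g) {G : J → Y → ℝ} (hG : ∀ j, LowerSemicontinuous (G j))
    (hmono : Monotone G) (hlub : ∀ x ∈ K, IsLUB (Set.range fun j => G j x) (g x))
    {ε : ℝ} (hε : 0 < ε) : ∃ j, ∀ x ∈ K, g x - ε < G j x := by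
  have hopen (j : J) : IsOpen {x | g x - ε < G j x} := by
    have h : LowerSemicontinuous fun x => G j x + -g x :=
      (hG j).add hg.neg.lowerSemicontinuous
    convert h.isOpen_preimage (-ε) using 1
    ext x
    simp only [Set.mem_ofPred_eq, Set.mem_preimage, Set.mem_Ioi]
    constructor <;> intro h <;> linarith
  refine hK.elim_directed_cover _ hopen (fun x hx => ?_) ?_
  · obtain ⟨_, ⟨j, rfl⟩, hj, -⟩ := (hlub x hx).exists_between (sub_lt_self (g x) hε)
    exact Set.mem_iUnion.2 ⟨j, hj⟩
  · exact directed_of_isDirected_le fun i j hij x hx => lt_of_lt_of_le hx (hmono hij x)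

/-- The pullback to `ℝ × ℝ^{2n}` of the function that is the tent `max 0 (1 - |λ|)` off the
slice `λ = 0`, and the tent centred at `c` on that slice. -/
noncomputable def heisTentAux (n : ℕ) (c : Fin (2 * n) → ℝ) (p : ℝ × (Fin (2 * n) → ℝ)) : ℝ :=
  if p.1 = 0 then max 0 (1 - ‖p.2 - c‖) else max 0 (1 - |p.1|)

/-- The function on the dual induced by `heisTentAux`. -/
noncomputable def heisTent (n : ℕ) (c : Fin (2 * n) → ℝ) : HeisDual n → ℝ :=
  Quotient.lift (heisTentAux n c) (by
    rintro ⟨a, v⟩ ⟨b, w⟩ ⟨h1, h2⟩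
    dsimp only at h1 h2
    subst h1
    rcases h2 with h | rfl
    · simp [heisTentAux, h]
    · rfl)

theorem heisTent_zero (n : ℕ) (c v : Fin (2 * n) → ℝ) :
    heisTent n c (heisQ n (0, v)) = max 0 (1 - ‖v - c‖) :=
  if_pos rfl

theorem heisTent_of_ne (n : ℕ) (c v : Fin (2 * n) → ℝ) {l : ℝ} (hl : l ≠ 0) :
    heisTent n c (heisQ n (l, v)) = max 0 (1 - |l|) :=
  if_neg hl

theorem heisQ_eq_of_ne (n : ℕ) {l : ℝ} (hl : l ≠ 0) (v w : Fin (2 * n) → ℝ) :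
    heisQ n (l, v) = heisQ n (l, w) :=
  Quotient.sound ⟨rfl, Or.inl hl⟩

theorem lowerSemicontinuous_heisTent (n : ℕ) (c : Fin (2 * n) → ℝ) :
    LowerSemicontinuous (heisTent n c) := by
  rw [lowerSemicontinuous_iff_isOpen_preimage]
  intro a
  rw [← isQuotientMap_quotient_mk'.isOpen_preimage]
  have hset : Quotient.mk (heisSetoid n) ⁻¹' (heisTent n c ⁻¹' Set.Ioi a) =
      {p | a < max 0 (1 - |p.1|)} ∩ ({p | p.1 ≠ 0} ∪ {p | a < max 0 (1 - ‖p.2 - c‖)}) := by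
    ext ⟨l, v⟩
    change a < heisTent n c (heisQ n (l, v)) ↔
      a < max 0 (1 - |l|) ∧ (l ≠ 0 ∨ a < max 0 (1 - ‖v - c‖))
    by_cases hl : l = 0
    · subst hl
      have h : max 0 (1 - ‖v - c‖) ≤ 1 := max_le zero_le_one (by simp)
      rw [heisTent_zero]
      simp only [ne_eq, not_true_eq_false, false_or, abs_zero, sub_zero]
      exact ⟨fun ha => ⟨(ha.trans_le h).trans_le (le_max_right _ _), ha⟩, And.right⟩
    · simp [heisTent_of_ne n c v hl, hl]
  refine hset ▸ (isOpen_lt (by fun_prop) (by fun_prop)).inter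
    ((isOpen_ne_fun (by fun_prop) (by fun_prop)).union (isOpen_lt (by fun_prop) (by fun_prop)))

theorem heisTent_nonneg (n : ℕ) (c : Fin (2 * n) → ℝ) (x : HeisDual n) : 0 ≤ heisTent n c x := by
  induction x using Quotient.inductionOn with
  | h p =>
    change 0 ≤ heisTentAux n c p
    unfold heisTentAux
    split_ifs <;> exact le_max_left _ _

theorem heisTent_le_one (n : ℕ) (c : Fin (2 * n) → ℝ) (x : HeisDual n) : heisTent n c x ≤ 1 := by
  induction x using Quotient.inductionOn with
  | h p =>
    change heisTentAux n c p ≤ 1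
    unfold heisTentAux
    split_ifs <;> simp

theorem isDiniFunction_heisTent (n : ℕ) (c : Fin (2 * n) → ℝ) :
    IsDiniFunction (heisTent n c) := by
  refine ⟨heisTent_nonneg n c, ⟨1, heisTent_le_one n c⟩, lowerSemicontinuous_heisTent n c, ?_⟩
  intro J _ _ _ F hF0 hF hmono hlub
  rw [Metric.tendstoUniformly_iff]
  intro ε hε
  obtain ⟨_, ⟨j₁, rfl⟩, hj₁, -⟩ :=
    (hlub (heisQ n (0, c))).exists_between (sub_lt_self _ hε)
  simp only [heisTent_zero, sub_self, norm_zero, sub_zero, zero_le_one, sup_of_le_right] at hj₁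
  have hline (j : J) : LowerSemicontinuous fun l : ℝ => F j (heisQ n (l, c)) :=
    (hF j).comp ((continuous_heisQ n).comp (by fun_prop))
  obtain ⟨δ, hδ, hnear⟩ := Metric.isOpen_iff.1 ((hline j₁).isOpen_preimage (1 - ε)) 0 hj₁
  obtain ⟨j₂, hj₂⟩ := ((isCompact_closedBall (0 : ℝ) 1).diff
      (Metric.isOpen_ball (x := 0) (ε := δ))).exists_forall_sub_lt_of_lowerSemicontinuous
    (g := fun l : ℝ => max 0 (1 - |l|)) (by fun_prop) hline (fun i j hij l => hmono hij _)
    (fun l hl => by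
      have h0 : l ≠ 0 := by
        rintro rfl
        exact hl.2 (Metric.mem_ball_self hδ)
      simpa only [heisTent_of_ne n c c h0] using hlub (heisQ n (l, c))) hε
  obtain ⟨j₃, hj₃⟩ :=
    (isCompact_closedBall c 1).exists_forall_sub_lt_of_lowerSemicontinuous
      (g := fun v => max 0 (1 - ‖v - c‖)) (G := fun j v => F j (heisQ n (0, v))) (by fun_prop)
      (fun j => (hF j).comp ((continuous_heisQ n).comp (by fun_prop)))
      (fun i j hij v => hmono hij _)
      (fun v _ => by simpa only [heisTent_zero] using hlub (heisQ n (0, v))) hε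
  obtain ⟨j₄, h₁₄, h₂₄⟩ := exists_ge_ge j₁ j₂
  obtain ⟨j₀, h₄₀, h₃₀⟩ := exists_ge_ge j₄ j₃
  filter_upwards [Filter.eventually_ge_atTop j₀] with j hj x
  have hle : F j x ≤ heisTent n c x := (hlub x).1 ⟨j, rfl⟩
  rw [Real.dist_eq, abs_of_nonneg (sub_nonneg.2 hle), sub_lt_comm]
  induction x using Quotient.inductionOn with
  | h p =>
    obtain ⟨l, v⟩ := p
    change heisTent n c (heisQ n (l, v)) - ε < F j (heisQ n (l, v))
    by_cases hl : l = 0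
    · subst hl
      rw [heisTent_zero]
      by_cases hv : v ∈ Metric.closedBall c 1
      · exact (hj₃ v hv).trans_le (hmono (h₃₀.trans hj) _)
      · rw [mem_closedBall_iff_norm, not_le] at hv
        rw [max_eq_left (by linarith)]
        linarith [hF0 j (heisQ n (0, v))]
    · rw [heisTent_of_ne n c v hl, heisQ_eq_of_ne n hl v c]
      by_cases hlδ : l ∈ Metric.ball (0 : ℝ) δ
      · have h₁ : 1 - ε < F j₁ (heisQ n (l, c)) := hnear hlδ
        have h₂ := hmono ((h₁₄.trans h₄₀).trans hj) (heisQ n (l, c))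
        have h₃ : max 0 (1 - |l|) ≤ 1 := max_le zero_le_one (by simp)
        linarith
      · by_cases hl1 : l ∈ Metric.closedBall (0 : ℝ) 1
        · exact (hj₂ l ⟨hl1, hlδ⟩).trans_le (hmono ((h₂₄.trans h₄₀).trans hj) _)
        · rw [mem_closedBall_zero_iff, Real.norm_eq_abs, not_le] at hl1
          rw [max_eq_left (by linarith)]
          linarith [hF0 j (heisQ n (l, c))]

/-- The absolute value of the first coordinate, as a function on the dual. -/
def heisAbs (n : ℕ) : HeisDual n → ℝ :=
  Quotient.lift (fun p => |p.1|) fun _ _ h => congrArg abs h.1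

theorem continuous_heisAbs (n : ℕ) : Continuous (heisAbs n) :=
  Continuous.quotient_lift (by fun_prop) _

/-- A Dini function bounded by `a` on the slice `λ = 0` cannot stay above some `b > a` at points
approaching that slice from outside. -/
theorem IsDiniFunction.exists_lt_of_le_on_zero {n : ℕ} {h : HeisDual n → ℝ} (hh : IsDiniFunction h)
    {a b : ℝ} (ha : 0 ≤ a) (hab : a < b) (hzero : ∀ v, h (heisQ n (0, v)) ≤ a) :
    ∃ δ > 0, ∀ l v, 0 < l → l < δ → h (heisQ n (l, v)) < b := by
  obtain ⟨h0, -, hlsc, hD⟩ := hh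
  have habs (x) : 0 ≤ heisAbs n x := Quotient.inductionOn x fun p => abs_nonneg p.1
  have hcont (j : ℕ) : Continuous fun x => a + j * heisAbs n x := by
    have := continuous_heisAbs n
    fun_prop
  have hunif := hD ℕ inferInstance inferInstance inferInstance
    (fun j x => min (h x) (a + j * heisAbs n x))
    (fun j x => le_min (h0 x) (by have := habs x; positivity))
    (fun j => hlsc.inf (hcont j).lowerSemicontinuous)
    (fun i j hij x => by
      have := habs x
      dsimp only
      gcongr)
    (fun x => by
      refine IsGreatest.isLUB ⟨?_, ?_⟩
      · induction x using Quotient.inductionOn with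
        | h p =>
          obtain ⟨l, v⟩ := p
          change h (heisQ n (l, v)) ∈
            Set.range fun j : ℕ => min (h (heisQ n (l, v))) (a + j * |l|)
          by_cases hl : l = 0
          · subst hl
            exact ⟨0, min_eq_left (by simpa using hzero v)⟩
          · obtain ⟨j, hj⟩ := exists_nat_ge (h (heisQ n (l, v)) / |l|)
            rw [div_le_iff₀ (abs_pos.2 hl)] at hj
            exact ⟨j, min_eq_left (by linarith)⟩
      · rintro _ ⟨j, rfl⟩
        exact min_le_left _ _)
  rw [Metric.tendstoUniformly_iff] at hunif
  obtain ⟨j, hj⟩ := (hunif ((b - a) / 2) (by linarith)).exists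
  refine ⟨(b - a) / 2 / (j + 1), div_pos (by linarith) (by positivity), fun l v hl hlδ => ?_⟩
  rw [lt_div_iff₀ (by positivity)] at hlδ
  have h₁ := (le_abs_self _).trans_lt (hj (heisQ n (l, v)))
  have h₂ : min (h (heisQ n (l, v))) (a + j * heisAbs n (heisQ n (l, v))) ≤ a + j * |l| :=
    min_le_right _ _
  rw [abs_of_pos hl] at h₂
  linarith

/-- On the unitary dual of the Heisenberg group, the set of Dini functions is not closed
under pointwise sum, pointwise product, or pointwise minimum. -/
theorem stmt15 (n : ℕ) (hn : 1 ≤ n) :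
    (∃ f g : HeisDual n → ℝ, IsDiniFunction f ∧ IsDiniFunction g ∧
      ¬ IsDiniFunction (fun x => f x + g x)) ∧
    (∃ f g : HeisDual n → ℝ, IsDiniFunction f ∧ IsDiniFunction g ∧
      ¬ IsDiniFunction (fun x => f x * g x)) ∧
    (∃ f g : HeisDual n → ℝ, IsDiniFunction f ∧ IsDiniFunction g ∧
      ¬ IsDiniFunction (fun x => min (f x) (g x))) := by
  have : Nonempty (Fin (2 * n)) := ⟨⟨0, by omega⟩⟩
  set c : Fin (2 * n) → ℝ := fun _ => 2 with hc
  have hnorm : ‖c‖ = 2 := by rw [hc, pi_norm_const]; norm_num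
  have hsep (v : Fin (2 * n) → ℝ) : 2 ≤ ‖v - 0‖ + ‖v - c‖ := by
    rw [sub_zero]
    have := norm_sub_le v (v - c)
    rwa [sub_sub_cancel, hnorm] at this
  have hdisj (v : Fin (2 * n) → ℝ) :
      max 0 (1 - ‖v - 0‖) = 0 ∨ max 0 (1 - ‖v - c‖) = 0 := by
    rcases le_total 1 ‖v - 0‖ with h | h
    · exact Or.inl (max_eq_left (by linarith))
    · exact Or.inr (max_eq_left (by linarith [hsep v]))
  have hsmall {δ : ℝ} (hδ : 0 < δ) : ∃ l, 0 < l ∧ l < δ ∧ l < 1 / 4 ∧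
      ∀ d, heisTent n d (heisQ n (l, 0)) = 1 - l := by
    obtain ⟨l, hl, hlt⟩ := exists_between (lt_min hδ (by norm_num : (0 : ℝ) < 1 / 4))
    obtain ⟨h₁, h₂⟩ := lt_min_iff.1 hlt
    refine ⟨l, hl, h₁, h₂, fun d => ?_⟩
    rw [heisTent_of_ne n d 0 hl.ne', abs_of_pos hl, max_eq_right (by linarith)]
  refine ⟨⟨heisTent n 0, heisTent n c, isDiniFunction_heisTent n 0, isDiniFunction_heisTent n c,
      fun h => ?_⟩, ⟨heisTent n 0, heisTent n c, isDiniFunction_heisTent n 0,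
      isDiniFunction_heisTent n c, fun h => ?_⟩, ⟨heisTent n 0, heisTent n c,
      isDiniFunction_heisTent n 0, isDiniFunction_heisTent n c, fun h => ?_⟩⟩
  · obtain ⟨δ, hδ, H⟩ := h.exists_lt_of_le_on_zero (a := 1) (b := 3 / 2) zero_le_one
      (by norm_num) fun v => by
        have h₁ := heisTent_le_one n 0 (heisQ n (0, v))
        have h₂ := heisTent_le_one n c (heisQ n (0, v))
        rw [heisTent_zero] at h₁ h₂ ⊢
        rw [heisTent_zero]
        rcases hdisj v with h | h <;> rw [h] <;> linarith
    obtain ⟨l, hl, hlδ, hl4, hT⟩ := hsmall hδ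
    have := H l 0 hl hlδ
    rw [hT, hT] at this
    linarith
  · obtain ⟨δ, hδ, H⟩ := h.exists_lt_of_le_on_zero (a := 0) (b := 1 / 2) le_rfl
      (by norm_num) fun v => by
        rw [heisTent_zero, heisTent_zero]
        rcases hdisj v with h | h <;> rw [h] <;> simp
    obtain ⟨l, hl, hlδ, hl4, hT⟩ := hsmall hδ
    have := H l 0 hl hlδ
    rw [hT, hT] at this
    nlinarith
  · obtain ⟨δ, hδ, H⟩ := h.exists_lt_of_le_on_zero (a := 0) (b := 1 / 2) le_rfl
      (by norm_num) fun v => by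
        rw [heisTent_zero, heisTent_zero]
        rcases hdisj v with h | h <;> rw [h] <;> simp
    obtain ⟨l, hl, hlδ, hl4, hT⟩ := hsmall hδ
    have := H l 0 hl hlδ
    rw [hT, hT, min_self] at this
    linarith
end
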